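/- arXiv:1803.01739 — 4 statements merged into one kernel-verified Lean document; each statement's English description precedes it below -/
import Mathlib

section
/- Let V = [p, k, j, ε] with 1 ≤ j ≤ 2k−1 and ε ∈ F_p^*. Let β ∈ F(p) be the unique infinite continued fraction satisfying β = [w_{2k−j+1}T, w_{2k−j+2}T, ..., w_{2k}T, β_{j+1}] and β^p = ε^{−1}·(−1)^{k+j}·(P_k·β_{j+1} − R_k). Then H(V)(1/β) = 0. -/
open Polynomial

noncomputable section

/-- The continuant of a finite word: `⟨∅⟩ = 1`, `⟨u₁⟩ = u₁`, and
`⟨u₁,…,uₘ⟩ = uₘ·⟨u₁,…,u_{m-1}⟩ + ⟨u₁,…,u_{m-2}⟩`. -/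
def cont {R : Type*} [CommRing R] (l : List R) : R :=
  (l.foldl (fun q a => (a * q.1 + q.2, q.1)) ((1 : R), (0 : R))).1

/-- `1/T`, viewed in the field `F(p) = F_p((1/T))` of Laurent series in `1/T`. -/
def Tinv (K : Type*) [Field K] : LaurentSeries K := HahnSeries.single (-1 : ℤ) 1

/-- `P_k(T) = (T² - 1)^k` in `F_p[T]`. -/
def Pk (p k : ℕ) : Polynomial (ZMod p) := ((X : Polynomial (ZMod p)) ^ 2 - 1) ^ k

/-- `R_k`, the remainder in the Euclidean division of `T^p` by `P_k`. -/
def Rk (p k : ℕ) : Polynomial (ZMod p) := (X : Polynomial (ZMod p)) ^ p %ₘ Pk p k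

/-- Continuants with an index shift: `NN w n (l+1)` is `⟨w_n T, …, w_{n+l-1} T⟩`. -/
def NN {F : Type*} [Field F] (w : ℕ → F) (n : ℕ) : ℕ → Polynomial F
  | 0 => 0
  | 1 => 1
  | (l + 2) => C (w (n + l)) * X * NN w n (l + 1) + NN w n l

section aux
variable {F : Type*} [Field F]

theorem NN_zero (w : ℕ → F) (n : ℕ) : NN w n 0 = 0 := by rw [NN]
theorem NN_one (w : ℕ → F) (n : ℕ) : NN w n 1 = 1 := by rw [NN]
theorem NN_add_two (w : ℕ → F) (n l : ℕ) :
    NN w n (l + 2) = C (w (n + l)) * X * NN w n (l + 1) + NN w n l := by rw [NN]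

theorem cont_eq_NN (w : ℕ → F) (n l : ℕ) :
    cont ((List.range l).map fun i => C (w (n + i)) * X) = NN w n (l + 1) := by
  have h : (((List.range l).map fun i => C (w (n + i)) * X).foldl
      (fun q a => (a * q.1 + q.2, q.1)) ((1 : Polynomial F), (0 : Polynomial F)))
      = (NN w n (l + 1), NN w n l) := by
    induction l with
    | zero => simp [NN_zero, NN_one]
    | succ l ih =>
      rw [List.range_succ, List.map_append, List.foldl_append, ih]
      simp [NN_add_two]
  unfold cont
  rw [h]

theorem NN_left (w : ℕ → F) (n l : ℕ) :
    NN w n (l + 2) = C (w n) * X * NN w (n + 1) (l + 1) + NN w (n + 2) l := by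
  induction l using Nat.twoStepInduction with
  | zero => simp [NN_add_two, NN_zero, NN_one]
  | one => simp [NN_add_two, NN_zero, NN_one]; ring
  | more l h1 h2 =>
    rw [NN_add_two w n (l + 2), h2, h1, NN_add_two w (n + 1) (l + 1), NN_add_two w (n + 2) l]
    rw [show n + (l + 2) = n + 2 + l by ring, show n + 1 + (l + 1) = n + 2 + l by ring]
    ring

theorem NN_rev (w : ℕ → F) (m l : ℕ) (hl : l ≤ m) :
    NN (fun i => w (m + 1 - i)) 1 (l + 1) = NN w (m + 1 - l) (l + 1) := by
  induction l using Nat.twoStepInduction with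
  | zero => simp [NN_one]
  | one => simp [NN_add_two, NN_zero, NN_one]
  | more l h1 h2 =>
    rw [NN_add_two, h2 (by omega), h1 (by omega), NN_left w (m + 1 - (l + 2)) (l + 1)]
    rw [show m + 1 - (1 + (l + 1)) = m + 1 - (l + 2) by omega,
      show m + 1 - (l + 2) + 1 = m + 1 - (l + 1) by omega,
      show m + 1 - (l + 2) + 2 = m + 1 - l by omega]

theorem NN_wronskian (w : ℕ → F) (l : ℕ) :
    NN w 1 (l + 2) * NN w 2 l - NN w 1 (l + 1) * NN w 2 (l + 1) = (-1) ^ (l + 1) := by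
  induction l with
  | zero => simp [NN_zero, NN_one]
  | succ l ih =>
    rw [NN_add_two w 1 (l + 1), NN_add_two w 2 l, pow_succ, ← ih,
      show 1 + (l + 1) = 2 + l by ring]
    ring

theorem NN_natDegree (w : ℕ → F) (n l : ℕ) : (NN w n (l + 1)).natDegree ≤ l := by
  induction l using Nat.twoStepInduction with
  | zero => simp [NN_one]
  | one =>
    rw [NN_add_two, NN_one, NN_zero]
    have h := (natDegree_C_mul_le (w n) X).trans natDegree_X_le
    simpa using h
  | more l h1 h2 =>
    rw [NN_add_two]
    refine (natDegree_add_le _ _).trans (max_le ?_ (h1.trans (by omega)))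
    refine natDegree_mul_le.trans ?_
    have := (natDegree_C_mul_le (w (n + (l + 1))) X).trans natDegree_X_le
    omega

theorem NN_coeff_zero (w : ℕ → F) (n m : ℕ) :
    (NN w n (2 * m)).coeff 0 = 0 ∧ (NN w n (2 * m + 1)).coeff 0 = 1 := by
  induction m with
  | zero => simp [NN_zero, NN_one]
  | succ m ih =>
    rw [show 2 * (m + 1) = 2 * m + 2 by ring, show 2 * m + 2 + 1 = (2 * m + 1) + 2 by ring,
      NN_add_two, NN_add_two]
    simp [ih.1, ih.2, mul_assoc]

/-- Ladder relations. -/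
theorem ladder (w : ℕ → F) (k : ℕ) (hw : ∀ i, 1 ≤ i → i ≤ 2 * k → w i ≠ 0)
    (hd : ∀ n, 1 ≤ n → n ≤ 2 * k → (2 * (n : F) - 1 - 2 * k) ≠ 0)
    (hrec : ∀ n, 1 ≤ n → n < 2 * k → w (n + 1) * w n * (n * (2 * k - n))
      = (2 * (n : F) + 1 - 2 * k) * (2 * (n : F) - 1 - 2 * k))
    (n : ℕ) (h1 : n + 1 ≤ 2 * k) :
    (C (2 * ((n : F) + 1) - 1 - 2 * k) * ((1 - X ^ 2) * derivative (NN w 1 (n + 2)))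
      = C (2 * ((n : F) + 1) - 1 - 2 * k) * (- C ((n : F) + 1) * X * NN w 1 (n + 2))
        + C (((n : F) + 1) * ((n : F) + 1 - 2 * k) * w (n + 1)) * NN w 1 (n + 1)) ∧
    (C (w (n + 1)) * ((1 - X ^ 2) * derivative (NN w 1 (n + 1)))
      = C (((n : F) + 1 - 2 * k) * w (n + 1)) * X * NN w 1 (n + 1)
        - C (2 * ((n : F) + 1) - 1 - 2 * k) * NN w 1 (n + 2)) := by
  induction n with
  | zero =>
    simp only [NN_add_two, NN_one, NN_zero, derivative_one, derivative_mul, derivative_add,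
      derivative_C, derivative_X, derivative_zero, zero_add, add_zero, Nat.cast_zero]
    simp only [map_sub, map_mul, map_add, map_one, map_ofNat]
    constructor <;> ring
  | succ n ih =>
    obtain ⟨A, B⟩ := ih (by omega)
    have r := hrec (n + 1) (by omega) (by omega)
    have hwn := hw (n + 1) (by omega) (by omega)
    have hdn := hd (n + 1) (by omega) (by omega)
    have hdn1 := hd (n + 1 + 1) (by omega) (by omega)
    have hf := NN_add_two w 1 (n + 1)
    rw [show 1 + (n + 1) = n + 1 + 1 by ring, show n + 1 + 1 = n + 2 by ring] at hf
    have hf' := congrArg derivative hf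
    simp only [derivative_mul, derivative_add, derivative_C, derivative_X, zero_mul, zero_add,
      mul_one] at hf'
    rw [show n + 1 + 1 = n + 2 by ring] at *
    have CR := congrArg (C : F → Polynomial F) r
    push_cast at *
    have hwn' : (C (w (n + 1)) : Polynomial F) ≠ 0 := by simpa using hwn
    have hdn' : (C (2 * ((n : F) + 1) - 1 - 2 * k) : Polynomial F) ≠ 0 := by
      simpa only [ne_eq, C_eq_zero] using hdn
    simp only [map_sub, map_mul, map_add, map_one, map_ofNat] at *
    generalize NN w 1 (n + 1) = f0 at *
    generalize NN w 1 (n + 1 + 2) = f2 at *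
    generalize NN w 1 (n + 2) = f1 at *
    have B' : C (w (n + 2)) * ((1 - X ^ 2) * derivative f1)
      = (((C (n : F) + 1 + 1 - 2 * C (k : F)) * C (w (n + 2))) * X * f1
        - (2 * (C (n : F) + 1 + 1) - 1 - 2 * C (k : F)) * f2) := by
      apply mul_left_cancel₀ hdn'
      linear_combination C (w (n + 2)) * A + (2 * (C (n : F) + 1) - 1 - 2 * C (k : F)) * (2 * (C (n : F) + 1 + 1) - 1 - 2 * C (k : F)) * hf
        - f0 * CR
    refine ⟨?_, B'⟩
    apply mul_left_cancel₀ hwn'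
    linear_combination C (w (n + 1)) * (2 * (C (n : F) + 1 + 1) - 1 - 2 * C (k : F)) * (1 - X ^ 2) * hf'
      + C (w (n + 1)) * (2 * (C (n : F) + 1 + 1) - 1 - 2 * C (k : F)) * X * B'
      + (2 * (C (n : F) + 1 + 1) - 1 - 2 * C (k : F)) * B
      - C (w (n + 1)) * (2 * (C (n : F) + 1 + 1) - 1 - 2 * C (k : F)) * X * (C (n : F) + 1 - 2 * C (k : F)) * hf
      + f1 * CR
end aux

section modp
variable {p : ℕ} [Fact (Nat.Prime p)]

theorem cast_ne (m : ℕ) (h0 : 0 < m) (h1 : m < p) : (m : ZMod p) ≠ 0 := by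
  rw [Ne, ZMod.natCast_eq_zero_iff]
  exact Nat.not_dvd_of_pos_of_lt h0 h1

theorem ode_zero (f : Polynomial (ZMod p)) (s c : ZMod p) (hdeg : f.natDegree < p)
    (h0 : f.coeff 0 = 0)
    (h : derivative f = X * (C s * (X * derivative f) - C c * f)) : f = 0 := by
  have key : ∀ m, m < p → f.coeff m = 0 := by
    intro m
    induction m using Nat.strong_induction_on with
    | _ m ih =>
      intro hm
      rcases m with _ | n
      · exact h0
      have hn := cast_ne (n + 1) (by omega) hm
      have e := congrArg (fun q => coeff q n) h
      simp only [coeff_derivative] at e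
      have z : (X * (C s * (X * derivative f) - C c * f)).coeff n = 0 := by
        rcases n with _ | r
        · simp
        rw [coeff_X_mul, coeff_sub, coeff_C_mul, coeff_C_mul, ih r (by omega) (by omega)]
        rcases r with _ | q
        · simp
        rw [coeff_X_mul, coeff_derivative, ih (q + 1) (by omega) (by omega)]
        simp
      rw [z] at e
      push_cast at hn
      exact (mul_eq_zero.mp e).resolve_right hn
  ext m
  by_cases hm : m < p
  · simpa using key m hm
  · rw [coeff_eq_zero_of_natDegree_lt (by omega)]; simp

theorem Pk_natDegree (k : ℕ) : (Pk p k).natDegree ≤ 2 * k := by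
  unfold Pk
  refine natDegree_pow_le.trans ?_
  have : ((X : Polynomial (ZMod p)) ^ 2 - 1).natDegree ≤ 2 := by compute_degree
  nlinarith

theorem Pk_monic (k : ℕ) : (Pk p k).Monic := by
  unfold Pk
  apply Monic.pow
  monicity!

theorem Pk_deriv (k : ℕ) : derivative (Pk p (k + 1)) = C (2 * ((k : ZMod p) + 1)) * X * Pk p k := by
  unfold Pk
  rw [derivative_pow]
  simp only [derivative_sub, derivative_one, derivative_X_pow, map_mul, map_add, map_one,
    map_ofNat, map_natCast]
  simp
  ring

/-- The two consequences of the ladder relations. -/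
theorem top_facts (w : ℕ → ZMod p) (k : ℕ) (hk1 : 1 ≤ k) (hk2 : 2 * k < p)
    (hw : ∀ i, 1 ≤ i → i ≤ 2 * k → w i ≠ 0)
    (hd : ∀ n : ℕ, 1 ≤ n → n ≤ 2 * k → (2 * (n : ZMod p) - 1 - 2 * k) ≠ 0)
    (hrec : ∀ n, 1 ≤ n → n < 2 * k → w (n + 1) * w n * (n * (2 * k - n))
      = (2 * (n : ZMod p) + 1 - 2 * k) * (2 * (n : ZMod p) - 1 - 2 * k)) :
    NN w 1 (2 * k + 1) = C ((-1) ^ k) * Pk p k ∧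
    C (w (2 * k)) * derivative (NN w 1 (2 * k))
      = C ((-1) ^ k * (2 * (k : ZMod p) - 1)) * Pk p (k - 1) := by
  obtain ⟨m, rfl⟩ : ∃ m, k = m + 1 := ⟨k - 1, by omega⟩
  obtain ⟨A, B⟩ := ladder w (m + 1) hw hd hrec (2 * m + 1) (by omega)
  have hdn := hd (2 * m + 2) (by omega) (by omega)
  rw [show 2 * m + 1 + 2 = 2 * m + 3 by ring, show 2 * m + 1 + 1 = 2 * m + 2 by ring] at A B
  rw [show 2 * (m + 1) + 1 = 2 * m + 3 by ring, show 2 * (m + 1) = 2 * m + 2 by ring,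
    show m + 1 - 1 = m by omega]
  push_cast at *
  have e1 : (2 * (m : ZMod p) + 1 + 1 - 2 * (m + 1)) = 0 := by ring
  have e2 : (2 * (2 * (m : ZMod p) + 1 + 1) - 1 - 2 * (m + 1)) = 2 * m + 1 := by ring
  have e3 : (2 * (2 * (m : ZMod p) + 2) - 1 - 2 * (m + 1)) = 2 * m + 1 := by ring
  have e4 : (2 * (m : ZMod p) + 1 + 1) = 2 * (m + 1) := by ring
  rw [e3] at hdn
  rw [e1, e2] at A B
  rw [e4] at A
  simp only [mul_zero, zero_mul, map_zero, add_zero, zero_sub] at A B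
  have hdC : (C (2 * (m : ZMod p) + 1) : Polynomial (ZMod p)) ≠ 0 := by
    simpa only [ne_eq, C_eq_zero] using hdn
  have A' := mul_left_cancel₀ hdC A
  have hf : NN w 1 (2 * m + 3) = C ((-1) ^ (m + 1)) * Pk p (m + 1) := by
    rw [← sub_eq_zero]
    apply ode_zero _ 1 (2 * ((m : ZMod p) + 1))
    · have d1 : (NN w 1 (2 * m + 3)).natDegree ≤ 2 * m + 2 := NN_natDegree w 1 (2 * m + 2)
      have d2 := (natDegree_C_mul_le ((-1) ^ (m + 1)) (Pk p (m + 1))).trans (Pk_natDegree (m + 1))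
      have d3 := natDegree_sub_le (NN w 1 (2 * m + 3)) (C ((-1) ^ (m + 1)) * Pk p (m + 1))
      have := max_le d1 (d2.trans (by omega : 2 * (m + 1) ≤ 2 * m + 2))
      omega
    · have := (NN_coeff_zero w 1 (m + 1)).2
      rw [show 2 * (m + 1) + 1 = 2 * m + 3 by ring] at this
      rw [coeff_sub, this, coeff_C_mul]
      simp only [Pk, coeff_zero_eq_eval_zero]
      simp [← mul_pow]
    · rw [derivative_sub, derivative_C_mul, Pk_deriv]
      have hP : Pk p (m + 1) = (X ^ 2 - 1) * Pk p m := by unfold Pk; ring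
      rw [hP]
      simp only [map_one]
      linear_combination A'
  refine ⟨hf, ?_⟩
  rw [hf] at B
  have hP : Pk p (m + 1) = (X ^ 2 - 1) * Pk p m := by unfold Pk; ring
  rw [hP] at B
  have hx : (X ^ 2 - 1 : Polynomial (ZMod p)) ≠ 0 := by
    have : (X ^ 2 - 1 : Polynomial (ZMod p)).Monic := by monicity!
    exact this.ne_zero
  apply mul_left_cancel₀ hx
  simp only [map_mul, map_add, map_sub, map_one, map_ofNat] at *
  linear_combination -B

/-- Antiderivatives of `Pk p (k-1)`; index `m` corresponds to `k = m+1`. -/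
def JJ (p : ℕ) [Fact (Nat.Prime p)] : ℕ → Polynomial (ZMod p)
  | 0 => X
  | (m + 1) => C ((2 * (m : ZMod p) + 3)⁻¹) *
      (X * Pk p (m + 1) - C (2 * ((m : ZMod p) + 1)) * JJ p m)

theorem JJ_facts (m : ℕ) (hm : 2 * (m + 1) < p) :
    derivative (JJ p m) = Pk p m ∧ (JJ p m).natDegree ≤ 2 * m + 1 ∧ (JJ p m).coeff 0 = 0 ∧
    (JJ p m).eval (-1) = -(JJ p m).eval 1 ∧
    2 * ((m : ZMod p) + 1) * ((-1) ^ m * ∏ i ∈ Finset.Icc 1 (m + 1), (1 - (2 * (i : ZMod p))⁻¹))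
      * (JJ p m).eval 1 = 1 := by
  induction m with
  | zero =>
    have h2 : (2 : ZMod p) ≠ 0 := by exact_mod_cast cast_ne 2 (by omega) (by omega)
    refine ⟨by simp [JJ, Pk], by simp [JJ], by simp [JJ], by simp [JJ], ?_⟩
    simp [JJ]
    field_simp
    norm_num
  | succ m ih =>
    obtain ⟨i1, i2, i3, i4, i5⟩ := ih (by omega)
    have h3 : (2 * (m : ZMod p) + 3) ≠ 0 := by
      exact_mod_cast cast_ne (2 * m + 3) (by omega) (by omega)
    have h2 : (2 : ZMod p) ≠ 0 := by exact_mod_cast cast_ne 2 (by omega) (by omega)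
    have hm2 : ((m : ZMod p) + 2) ≠ 0 := by exact_mod_cast cast_ne (m + 2) (by omega) (by omega)
    have hP : Pk p (m + 1) = (X ^ 2 - 1) * Pk p m := by unfold Pk; ring
    refine ⟨?_, ?_, ?_, ?_, ?_⟩
    · rw [JJ, derivative_C_mul, derivative_sub, derivative_mul, derivative_C_mul, i1, Pk_deriv, hP,
        derivative_X]
      have hC : (C ((2 * (m : ZMod p) + 3)⁻¹) : Polynomial (ZMod p)) * C (2 * (m : ZMod p) + 3) = 1 := by
        rw [← C_mul, inv_mul_cancel₀ h3, C_1]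
      simp only [map_mul, map_add, map_one, map_ofNat] at *
      linear_combination (X ^ 2 - 1) * Pk p m * hC
    · rw [JJ]
      refine (natDegree_C_mul_le _ _).trans ((natDegree_sub_le _ _).trans (max_le ?_ ?_))
      · refine natDegree_mul_le.trans ?_
        have := Pk_natDegree (p := p) (m + 1)
        rw [natDegree_X]; omega
      · exact (natDegree_C_mul_le _ _).trans (i2.trans (by omega))
    · rw [JJ, coeff_C_mul, coeff_sub, coeff_C_mul, i3]; simp
    · simp [JJ, i4, Pk]
    · rw [Finset.prod_Icc_succ_top (by omega)]
      have e : (JJ p (m + 1)).eval 1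
          = (2 * (m : ZMod p) + 3)⁻¹ * (-(2 * ((m : ZMod p) + 1)) * (JJ p m).eval 1) := by
        simp [JJ, Pk]
      rw [e]
      generalize (∏ i ∈ Finset.Icc 1 (m + 1), (1 - (2 * (i : ZMod p))⁻¹)) = Q at *
      generalize (JJ p m).eval 1 = E at *
      refine Eq.trans ?_ i5
      rw [pow_succ]
      push_cast
      rw [show (m : ZMod p) + 1 + 1 = m + 2 by ring]
      field_simp
      ring

theorem mult_step (f : Polynomial (ZMod p)) (a : ZMod p) (k : ℕ) (hk : k + 1 < p)
    (h0 : f.eval a = 0) (h : (X - C a) ^ k ∣ derivative f) : (X - C a) ^ (k + 1) ∣ f := by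
  have key : ∀ m, m ≤ k + 1 → (X - C a) ^ m ∣ f := by
    intro m
    induction m with
    | zero => simp
    | succ m ih =>
      intro hm
      obtain ⟨g, hg⟩ := ih (by omega)
      rcases Nat.eq_zero_or_pos m with rfl | hpos
      · rw [zero_add, pow_one, dvd_iff_isRoot]; exact h0
      obtain ⟨n, rfl⟩ : ∃ n, m = n + 1 := ⟨m - 1, by omega⟩
      have hd : (X - C a) ^ (n + 1) ∣ derivative f := (pow_dvd_pow _ (by omega)).trans h
      obtain ⟨q, hq⟩ := hd
      have hx : (X - C a : Polynomial (ZMod p)) ≠ 0 := X_sub_C_ne_zero a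
      have e : C ((n : ZMod p) + 1) * g = (X - C a) * (q - derivative g) := by
        apply mul_left_cancel₀ (pow_ne_zero n hx)
        rw [hg, derivative_mul, derivative_X_sub_C_pow] at hq
        simp only [map_add, map_one, map_natCast] at *
        push_cast at hq
        linear_combination hq
      have hn : ((n : ZMod p) + 1) ≠ 0 := by exact_mod_cast cast_ne (n + 1) (by omega) (by omega)
      have hg1 : (X - C a) ∣ g := by
        rw [dvd_iff_isRoot]
        have := congrArg (eval a) e
        simp only [eval_mul, eval_C, eval_sub, eval_X, sub_self, zero_mul] at this
        exact (mul_eq_zero.mp this).resolve_left hn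
      rw [hg, pow_succ]
      exact mul_dvd_mul_left _ hg1
  exact key _ le_rfl

theorem Rk_eq (m : ℕ) (hm : 2 * (m + 1) < p) (hodd : Odd p) (c : ZMod p)
    (hc : c * (JJ p m).eval 1 = 1) : Rk p (m + 1) = C c * JJ p m := by
  obtain ⟨i1, i2, i3, i4, -⟩ := JJ_facts (p := p) m hm
  have h2 : (2 : ZMod p) ≠ 0 := by exact_mod_cast cast_ne 2 (by omega) (by omega)
  have hder : derivative (X ^ p - C c * JJ p m) = - C c * Pk p m := by
    rw [derivative_sub, derivative_C_mul, i1, derivative_X_pow]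
    simp
  have hPf : Pk p m = (X - C 1) ^ m * (X - C (-1)) ^ m := by
    unfold Pk; rw [← mul_pow]; congr 1; simp; ring
  have hPf' : Pk p (m + 1) = (X - C 1) ^ (m + 1) * (X - C (-1)) ^ (m + 1) := by
    unfold Pk; rw [← mul_pow]; congr 1; simp; ring
  have d1 : (X - C (1 : ZMod p)) ^ (m + 1) ∣ X ^ p - C c * JJ p m := by
    apply mult_step _ _ _ (by omega)
    · simp [hc]
    · rw [hder, hPf]; exact ⟨- C c * (X - C (-1)) ^ m, by ring⟩
  have d2 : (X - C (-1 : ZMod p)) ^ (m + 1) ∣ X ^ p - C c * JJ p m := by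
    apply mult_step _ _ _ (by omega)
    · simp [i4, hc, hodd.neg_one_pow]
    · rw [hder, hPf]; exact ⟨- C c * (X - C 1) ^ m, by ring⟩
  have hcop : IsCoprime ((X - C (1 : ZMod p)) ^ (m + 1)) ((X - C (-1 : ZMod p)) ^ (m + 1)) := by
    apply IsCoprime.pow
    apply isCoprime_X_sub_C_of_isUnit_sub
    rw [isUnit_iff_ne_zero]
    intro h; apply h2; linear_combination h
  have hdvd : Pk p (m + 1) ∣ X ^ p - C c * JJ p m := by
    rw [hPf']; exact hcop.mul_dvd d1 d2
  obtain ⟨q, hq⟩ := hdvd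
  unfold Rk
  have hmon := Pk_monic (p := p) (m + 1)
  refine (div_modByMonic_unique q (C c * JJ p m) hmon ⟨?_, ?_⟩).2
  · linear_combination -hq
  · have hn : (Pk p (m + 1)).natDegree = 2 * (m + 1) := by
      unfold Pk
      rw [natDegree_pow]
      have : ((X : Polynomial (ZMod p)) ^ 2 - 1).natDegree = 2 := by compute_degree!
      rw [this]; ring
    apply degree_lt_degree
    rw [hn]
    exact lt_of_le_of_lt ((natDegree_C_mul_le _ _).trans i2) (by omega)

end modp

section fin
variable {p : ℕ} [Fact (Nat.Prime p)]

theorem main_facts (k : ℕ) (hodd : Odd p)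
    (hk1 : 1 ≤ k) (hk2 : 2 * k < p)
    (ω : ZMod p)
    (hω : ω = (-1) ^ (k - 1) * ∏ i ∈ Finset.Icc 1 k, (1 - (2 * (i : ZMod p))⁻¹))
    (w : ℕ → ZMod p)
    (hwne : ∀ i, 1 ≤ i → i ≤ 2 * k → w i ≠ 0)
    (hw1 : w 1 = (2 * (k : ZMod p) - 1) * (2 * (k : ZMod p) * ω)⁻¹)
    (hwrec : ∀ i, 1 ≤ i → i ≤ 2 * k - 1 →
      w (i + 1) * w i =
        (2 * (k : ZMod p) - 2 * (i : ZMod p) - 1) * (2 * (k : ZMod p) - 2 * (i : ZMod p) + 1)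
          * ((i : ZMod p) * (2 * (k : ZMod p) - (i : ZMod p)))⁻¹) :
    NN w 1 (2 * k + 1) = C ((-1) ^ k) * Pk p k ∧ NN w 2 (2 * k) = C ((-1) ^ k) * Rk p k ∧
    ∀ i, i < 2 * k → w (2 * k - i) = - w (i + 1) := by
  have hd : ∀ n : ℕ, 1 ≤ n → n ≤ 2 * k → (2 * (n : ZMod p) - 1 - 2 * k) ≠ 0 := by
    intro n h1 h2
    by_cases h : k + 1 ≤ n
    · have := cast_ne (p := p) (2 * n - 1 - 2 * k) (by omega) (by omega)
      rw [Nat.cast_sub (by omega), Nat.cast_sub (by omega)] at this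
      push_cast at this
      exact this
    · have := cast_ne (p := p) (2 * k + 1 - 2 * n) (by omega) (by omega)
      rw [Nat.cast_sub (by omega)] at this
      push_cast at this
      intro h'
      apply this
      linear_combination -h'
  have hrec : ∀ n, 1 ≤ n → n < 2 * k → w (n + 1) * w n * (n * (2 * k - n))
      = (2 * (n : ZMod p) + 1 - 2 * k) * (2 * (n : ZMod p) - 1 - 2 * k) := by
    intro n h1 h2
    have a1 := cast_ne (p := p) n (by omega) (by omega)
    have a2 := cast_ne (p := p) (2 * k - n) (by omega) (by omega)
    rw [Nat.cast_sub (by omega)] at a2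
    push_cast at a2
    rw [hwrec n h1 (by omega), mul_assoc, inv_mul_cancel₀ (mul_ne_zero a1 a2)]
    ring
  have hsymm : ∀ n, 1 ≤ n → n < 2 * k → w (2 * k - n) * w (2 * k + 1 - n) * (n * (2 * k - n))
      = (2 * (n : ZMod p) + 1 - 2 * k) * (2 * (n : ZMod p) - 1 - 2 * k) := by
    intro n h1 h2
    have := hrec (2 * k - n) (by omega) (by omega)
    rw [show 2 * k - n + 1 = 2 * k + 1 - n by omega, Nat.cast_sub (by omega)] at this
    push_cast at this
    linear_combination this
  obtain ⟨F1, F2⟩ := top_facts w k hk1 hk2 hwne hd hrec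
  obtain ⟨-, F3⟩ := top_facts (fun i => w (2 * k + 1 - i)) k hk1 hk2
    (fun i h1 h2 => hwne _ (by omega) (by omega)) hd (by
      intro n h1 h2
      have := hsymm n h1 h2
      rw [show 2 * k + 1 - (n + 1) = 2 * k - n by omega]
      exact this)
  have hr := NN_rev w (2 * k) (2 * k - 1) (by omega)
  rw [show 2 * k - 1 + 1 = 2 * k by omega, show 2 * k + 1 - (2 * k - 1) = 2 by omega] at hr
  rw [hr] at F3
  simp only [show 2 * k + 1 - 2 * k = 1 by omega] at F3
  have dg1 : (NN w 1 (2 * k)).natDegree < p := by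
    have := NN_natDegree w 1 (2 * k - 1)
    rw [show 2 * k - 1 + 1 = 2 * k by omega] at this
    omega
  have dg2 : (NN w 2 (2 * k)).natDegree < p := by
    have := NN_natDegree w 2 (2 * k - 1)
    rw [show 2 * k - 1 + 1 = 2 * k by omega] at this
    omega
  have hw1ne := hwne 1 le_rfl (by omega)
  have hw1C : (C (w 1) : Polynomial (ZMod p)) ≠ 0 := by simpa using hw1ne
  have hcne : 2 * (k : ZMod p) * ω ≠ 0 := by
    intro h; rw [h] at hw1; simp at hw1; exact hw1ne hw1
  have hwc : w 1 * (2 * (k : ZMod p) * ω) = 2 * k - 1 := by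
    rw [hw1, mul_assoc, inv_mul_cancel₀ hcne, mul_one]
  obtain ⟨m, hm⟩ : ∃ m, k = m + 1 := ⟨k - 1, by omega⟩
  obtain ⟨j1, j2, j3, j4, j5⟩ := JJ_facts (p := p) m (by omega)
  have hJ : 2 * (k : ZMod p) * ω * (JJ p m).eval 1 = 1 := by
    rw [hω, hm]; push_cast; simpa using j5
  have hR : Rk p k = C (2 * (k : ZMod p) * ω) * JJ p m := by
    rw [hm] at hJ ⊢
    exact Rk_eq m (by omega) hodd _ hJ
  have G2 : NN w 2 (2 * k) = C ((-1) ^ k) * Rk p k := by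
    rw [hR, ← sub_eq_zero]
    have hc0 := (NN_coeff_zero w 2 k).1
    apply ode_zero _ 0 0
    · refine lt_of_le_of_lt (natDegree_sub_le _ _) (max_lt dg2 ?_)
      refine lt_of_le_of_lt (natDegree_C_mul_le _ _) (lt_of_le_of_lt (natDegree_C_mul_le _ _) ?_)
      omega
    · simp [hc0, j3]
    · simp only [map_zero, zero_mul, sub_zero, mul_zero]
      apply mul_left_cancel₀ hw1C
      rw [derivative_sub, derivative_C_mul, derivative_C_mul, j1, mul_sub, F3,
        show k - 1 = m by omega, ← hwc]
      simp only [map_mul]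
      ring
  refine ⟨F1, G2, ?_⟩
  have G1 : C (w (2 * k)) * NN w 1 (2 * k) = C (w 1) * NN w 2 (2 * k) := by
    rw [← sub_eq_zero]
    apply ode_zero _ 0 0
    · exact lt_of_le_of_lt (natDegree_sub_le _ _) (max_lt
        (lt_of_le_of_lt (natDegree_C_mul_le _ _) dg1) (lt_of_le_of_lt (natDegree_C_mul_le _ _) dg2))
    · simp [(NN_coeff_zero w 1 k).1, (NN_coeff_zero w 2 k).1]
    · simp only [map_zero, zero_mul, sub_zero, mul_zero]
      rw [derivative_sub, derivative_C_mul, derivative_C_mul, F2, F3, sub_self]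
  have hW := NN_wronskian w (2 * k - 1)
  rw [show 2 * k - 1 + 1 = 2 * k by omega, show 2 * k - 1 + 2 = 2 * k + 1 by omega, F1] at hW
  have hW1 := congrArg (eval 1) hW
  have hG1 := congrArg (eval 1) G1
  have hP1 : (Pk p k).eval 1 = 0 := by simp [Pk]; omega
  have hN2 : (NN w 2 (2 * k)).eval 1 = (-1) ^ k := by
    rw [G2, hR]; simp only [eval_mul, eval_C]; rw [hJ, mul_one]
  simp only [eval_mul, eval_sub, eval_C, hP1, hN2, mul_zero, zero_mul, zero_sub, eval_pow, eval_neg,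
    eval_one, pow_mul, neg_one_sq, one_pow] at hW1 hG1
  have hsq : ((-1 : ZMod p) ^ k) * (-1) ^ k = 1 := by rw [← mul_pow]; simp
  have hlast : w (2 * k) = - w 1 := by
    linear_combination -w (2 * k) * hW1 - (-1) ^ k * hG1 - w 1 * hsq
  intro i
  induction i with
  | zero => intro _; simpa using hlast
  | succ i ih =>
    intro hi
    have h := ih (by omega)
    have r1 := hrec (i + 1) (by omega) hi
    have r2 := hsymm (i + 1) (by omega) hi
    have a1 := cast_ne (p := p) (i + 1) (by omega) (by omega)
    have a2 := cast_ne (p := p) (2 * k - (i + 1)) (by omega) (by omega)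
    rw [Nat.cast_sub (by omega)] at a2
    push_cast at a2 a1 r1 r2
    rw [h] at r2
    have := hwne (i + 1) (by omega) (by omega)
    apply mul_left_cancel₀ (mul_ne_zero this (mul_ne_zero a1 a2))
    linear_combination r1 - r2

end fin

theorem stmt_15 (p k : ℕ) [Fact (Nat.Prime p)] (hodd : Odd p)
    (hk1 : 1 ≤ k) (hk2 : 2 * k < p)
    (ω : ZMod p)
    (hω : ω = (-1) ^ (k - 1) * ∏ i ∈ Finset.Icc 1 k, (1 - (2 * (i : ZMod p))⁻¹))
    (w : ℕ → ZMod p)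
    (hwne : ∀ i, 1 ≤ i → i ≤ 2 * k → w i ≠ 0)
    (hw1 : w 1 = (2 * (k : ZMod p) - 1) * (2 * (k : ZMod p) * ω)⁻¹)
    (hwrec : ∀ i, 1 ≤ i → i ≤ 2 * k - 1 →
      w (i + 1) * w i =
        (2 * (k : ZMod p) - 2 * (i : ZMod p) - 1) * (2 * (k : ZMod p) - 2 * (i : ZMod p) + 1)
          * ((i : ZMod p) * (2 * (k : ZMod p) - (i : ZMod p)))⁻¹)
    -- the continuants `K_{n,m} = ⟨w_n T, …, w_m T⟩`
    (K : ℕ → ℕ → Polynomial (ZMod p))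
    (hK : ∀ n m, K n m = cont ((List.range (m + 1 - n)).map fun i => C (w (n + i)) * X))
    -- the polynomial `H(V)` for `V = [p, k, j, ε]`
    (H : ℕ → ZMod p → Polynomial (Polynomial (ZMod p)))
    (hH : ∀ j ε, H j ε
      = C (K (j + 2) (2 * k)) * X ^ (p + 1) - C (K (j + 1) (2 * k)) * X ^ p
        + C (C ε) * (C (K 1 j) * X + C (K 1 (j - 1))))
    (j : ℕ) (hj1 : 1 ≤ j) (hj2 : j ≤ 2 * k - 1) (ε : ZMod p) (hε : ε ≠ 0)
    -- `β = [w_{2k-j+1}T, …, w_{2k}T, β_{j+1}]`, an infinite continued fraction with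
    -- complete quotients `βs` (`β = βs 1`), and `β^p = ε⁻¹(-1)^{k+j}(P_k β_{j+1} - R_k)`
    (β : LaurentSeries (ZMod p)) (βs : ℕ → LaurentSeries (ZMod p)) (hβ1 : βs 1 = β)
    (hord : ∀ n, 1 ≤ n → (βs n).order < 0)
    (hinit : ∀ i, 1 ≤ i → i ≤ j →
      βs i = aeval (Tinv (ZMod p)) (C (w (2 * k - j + i)) * X) + (βs (i + 1))⁻¹)
    (htail : ∀ n, j < n → ∃ b : Polynomial (ZMod p),
      0 < b.degree ∧ βs n = aeval (Tinv (ZMod p)) b + (βs (n + 1))⁻¹)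
    (heq : β ^ p
      = algebraMap (ZMod p) (LaurentSeries (ZMod p)) (ε⁻¹ * (-1) ^ (k + j))
        * (aeval (Tinv (ZMod p)) (Pk p k) * βs (j + 1)
            - aeval (Tinv (ZMod p)) (Rk p k))) :
    Polynomial.eval₂
      ((aeval (Tinv (ZMod p)) : Polynomial (ZMod p) →ₐ[ZMod p] LaurentSeries (ZMod p)) :
        Polynomial (ZMod p) →+* LaurentSeries (ZMod p))
      β⁻¹ (H j ε) = 0 := by
  obtain ⟨F1, F2, F3⟩ := main_facts k hodd hk1 hk2 ω hω w hwne hw1 hwrec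
  have hne : ∀ n, 1 ≤ n → βs n ≠ 0 := by
    intro n hn h
    have := hord n hn
    rw [h] at this
    simp at this
  have hKN : ∀ n m, K n m = NN w n (m + 1 - n + 1) := fun n m => by rw [hK, cont_eq_NN]
  have hβ : β ≠ 0 := hβ1 ▸ hne 1 le_rfl
  have hβi : β * β⁻¹ = 1 := mul_inv_cancel₀ hβ
  rw [hH]
  simp only [eval₂_add, eval₂_sub, eval₂_mul, eval₂_C, eval₂_X, eval₂_pow, AlgHom.coe_toRingHom,
    RingHom.coe_coe]
  rw [hKN, hKN, hKN, hKN, show 2 * k + 1 - (j + 2) + 1 = 2 * k - j by omega,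
    show 2 * k + 1 - (j + 1) + 1 = 2 * k - j + 1 by omega, show j + 1 - 1 + 1 = j + 1 by omega,
    show j - 1 + 1 - 1 + 1 = j by omega]
  generalize hφ : (aeval (Tinv (ZMod p)) : Polynomial (ZMod p) →ₐ[ZMod p] LaurentSeries (ZMod p)) = φ at *
  have hQ : ∀ n, n ≤ j → φ (NN w (n + 2) (2 * k - n)) - φ (NN w (n + 1) (2 * k - n + 1)) * βs (j - n + 1)
      + (-1) ^ n * (φ (NN w 1 (2 * k + 1)) * βs (j + 1) - φ (NN w 2 (2 * k)))
        * (φ (NN w 1 (n + 1)) + φ (NN w 1 n) * βs (j - n + 1)) = 0 := by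
    intro n
    induction n with
    | zero => intro _; simp [NN_one, NN_zero]
    | succ n ih =>
      intro hn
      have h := ih (by omega)
      have hb := hinit (j - n) (by omega) (by omega)
      have hbne := mul_inv_cancel₀ (hne (j - n + 1) (by omega))
      rw [show 2 * k - j + (j - n) = 2 * k - n by omega, F3 n (by omega)] at hb
      rw [show j - (n + 1) + 1 = j - n by omega, hb]
      have L := NN_left w (n + 1) (2 * k - (n + 1))
      rw [show 2 * k - (n + 1) + 2 = 2 * k - n + 1 by omega, show 2 * k - (n + 1) + 1 = 2 * k - n by omega] at L
      rw [show 2 * k - (n + 1) + 1 = 2 * k - n by omega]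
      have N1 := NN_add_two w 1 n
      rw [show 1 + n = n + 1 by ring] at N1
      rw [L] at h
      rw [N1]
      simp only [map_add, map_mul, map_neg, pow_succ, show n + 1 + 1 = n + 2 by ring,
        show n + 1 + 2 = n + 3 by ring] at *
      generalize βs (j - n + 1) = b at *
      generalize φ (NN w 1 (2 * k + 1)) * βs (j + 1) - φ (NN w 2 (2 * k)) = M at *
      linear_combination (-b⁻¹) * h + (-(φ (C (w (n + 1))) * φ X * φ (NN w (n + 2) (2 * k - n)) + φ (NN w (n + 3) (2 * k - (n + 1))))
        + (-1) ^ n * M * φ (NN w 1 n)) * hbne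
  have hq := hQ j le_rfl
  rw [show j - j + 1 = 1 by omega, hβ1, F1, F2] at hq
  have hC : ∀ a, φ (C a) = algebraMap (ZMod p) (LaurentSeries (ZMod p)) a := fun a => by
    rw [← Polynomial.algebraMap_eq]; exact φ.commutes a
  simp only [map_mul, hC] at hq heq ⊢
  have hee : algebraMap (ZMod p) (LaurentSeries (ZMod p)) ε * algebraMap (ZMod p) (LaurentSeries (ZMod p)) ε⁻¹ = 1 := by
    rw [← map_mul, mul_inv_cancel₀ hε, map_one]
  simp only [map_pow, map_neg, map_one] at hq heq ⊢
  have heq2 : algebraMap (ZMod p) (LaurentSeries (ZMod p)) ε * β ^ p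
      = (-1) ^ (k + j) * (φ (Pk p k) * βs (j + 1) - φ (Rk p k)) := by
    rw [heq]
    linear_combination ((-1) ^ (k + j) * (φ (Pk p k) * βs (j + 1) - φ (Rk p k))) * hee
  apply mul_left_cancel₀ (pow_ne_zero (p + 1) hβ)
  have e1 : β ^ (p + 1) * β⁻¹ ^ (p + 1) = 1 := by rw [← mul_pow, hβi, one_pow]
  have e2 : β ^ (p + 1) * β⁻¹ ^ p = β := by
    rw [pow_succ, mul_right_comm, ← mul_pow, hβi, one_pow, one_mul]
  have e3 : β ^ (p + 1) * β⁻¹ = β ^ p := by rw [pow_succ, mul_assoc, hβi, mul_one]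
  have e4 : β ^ (p + 1) = β ^ p * β := pow_succ _ _
  have hpow : ((-1 : LaurentSeries (ZMod p))) ^ (k + j) = (-1) ^ k * (-1) ^ j := pow_add _ _ _
  rw [hpow] at heq2
  linear_combination φ (NN w (j + 2) (2 * k - j)) * e1 - φ (NN w (j + 1) (2 * k - j + 1)) * e2
    + algebraMap (ZMod p) (LaurentSeries (ZMod p)) ε * φ (NN w 1 (j + 1)) * e3
    + algebraMap (ZMod p) (LaurentSeries (ZMod p)) ε * φ (NN w 1 j) * e4
    + (φ (NN w 1 (j + 1)) + φ (NN w 1 j) * β) * heq2 + hq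
end
end

section
/- Let 1 ≤ j ≤ 2k−1 and ε ∈ F_p^*. Consider the P_k-expansion α defined by the (2k−j+2)-tuple Λ_α = (w_{j+1}, ..., w_{2k}, −ε_2, ε_2), where ε_2 = (−1)^{k+j+1}·ε (so ℓ = 2k−j, λ_i = w_{j+i}, ε_1 = −ε_2). Then: (i) Λ_α satisfies the condition H(A), namely [λ_ℓ, λ_{ℓ−1}, ..., λ_2, λ_1 − ε_2] = ε_1/(ε_2·ω_k), if and only if ε = ε_A := (−1)^{k+j+1}·[w_{j+1}, ..., w_{2k}, ω_k]; (ii) Λ_α satisfies the condition H(B), namely [λ_ℓ, λ_{ℓ−1}, ..., λ_1 − ε_2] = 0, if and only if ε = ε_B := (−1)^{k+j+1}·[w_{j+1}, ..., w_{2k}]. -/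
noncomputable section

/-- Finite continued fraction `[a₁,…,aₙ] = a₁ + 1/(a₂ + 1/(…))`. -/
def cfrac {K : Type*} [DivisionRing K] : List K → K
  | [] => 0
  | [a] => a
  | a :: b :: l => a + (cfrac (b :: l))⁻¹

theorem cfrac_append_one {K : Type*} [Field K] (m : List K) (x : K) :
    cfrac (m ++ [x]) = m.foldr (fun a y => a + y⁻¹) x := by
  induction m with
  | nil => simp [cfrac]
  | cons a m ih =>
    rw [List.foldr_cons, ← ih]
    cases m <;> simp [cfrac]

theorem foldl_eq_iff {K : Type*} [Field K] (l : List K) (x c : K) :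
    l.foldl (fun y a => a + y⁻¹) x = c ↔ -x = l.foldr (fun a y => (a + y)⁻¹) (-c) := by
  induction l generalizing x with
  | nil => simp
  | cons a l ih =>
    rw [List.foldl_cons, List.foldr_cons, ih, ← inv_eq_iff_eq_inv, inv_neg]
    constructor <;> intro h
    · rw [← h]; ring
    · linear_combination h

theorem cfrac_cons_append {K : Type*} [Field K] (l : List K) (a o : K) :
    cfrac (a :: (l ++ [o])) = a + l.foldr (fun a y => (a + y)⁻¹) o⁻¹ := by
  induction l generalizing a with
  | nil => simp [cfrac]
  | cons b l ih => simp only [List.cons_append, cfrac, List.foldr_cons, ih]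

theorem cfrac_cons_eq {K : Type*} [Field K] (l : List K) (a : K) :
    cfrac (a :: l) = a + l.foldr (fun a y => (a + y)⁻¹) 0 := by
  induction l generalizing a with
  | nil => simp [cfrac]
  | cons b l ih => simp only [cfrac, List.foldr_cons, ih]

theorem stmt_16 (p k : ℕ) [Fact (Nat.Prime p)] (hodd : Odd p)
    (hk1 : 1 ≤ k) (hk2 : 2 * k < p)
    (ω : ZMod p)
    (hω : ω = (-1) ^ (k - 1) * ∏ i ∈ Finset.Icc 1 k, (1 - (2 * (i : ZMod p))⁻¹))
    (w : ℕ → ZMod p)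
    (hwne : ∀ i, 1 ≤ i → i ≤ 2 * k → w i ≠ 0)
    (hw1 : w 1 = (2 * (k : ZMod p) - 1) * (2 * (k : ZMod p) * ω)⁻¹)
    (hwrec : ∀ i, 1 ≤ i → i ≤ 2 * k - 1 →
      w (i + 1) * w i =
        (2 * (k : ZMod p) - 2 * (i : ZMod p) - 1) * (2 * (k : ZMod p) - 2 * (i : ZMod p) + 1)
          * ((i : ZMod p) * (2 * (k : ZMod p) - (i : ZMod p)))⁻¹)
    (j : ℕ) (hj1 : 1 ≤ j) (hj2 : j ≤ 2 * k - 1) (ε : ZMod p) (hε : ε ≠ 0)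
    -- the tuple `Λ_α = (λ_1, …, λ_ℓ, ε_1, ε_2)` with `ℓ = 2k - j`, `λ_i = w_{j+i}`,
    -- `ε_2 = (-1)^{k+j+1}·ε` and `ε_1 = -ε_2`
    (ℓ : ℕ) (hℓ : ℓ = 2 * k - j)
    (lam : ℕ → ZMod p) (hlam : ∀ i, 1 ≤ i → i ≤ ℓ → lam i = w (j + i))
    (ε1 ε2 : ZMod p) (hε2 : ε2 = (-1) ^ (k + j + 1) * ε) (hε1 : ε1 = -ε2)
    -- the word `λ_ℓ, λ_{ℓ-1}, …, λ_2, λ_1 - ε_2`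
    (L : List (ZMod p))
    (hL : L = ((List.range (ℓ - 1)).map fun i => lam (ℓ - i)) ++ [lam 1 - ε2]) :
    (cfrac L = ε1 / (ε2 * ω) ↔
      ε = (-1) ^ (k + j + 1)
        * cfrac (((List.range (2 * k - j)).map fun i => w (j + 1 + i)) ++ [ω])) ∧
    (cfrac L = 0 ↔
      ε = (-1) ^ (k + j + 1)
        * cfrac ((List.range (2 * k - j)).map fun i => w (j + 1 + i))) := by
  obtain ⟨n, hn⟩ : ∃ n, 2 * k - j = n + 1 := ⟨2 * k - j - 1, by omega⟩
  set l : List (ZMod p) := (List.range n).map (fun i => w (j + 2 + i)) with hl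
  have hword : (List.range (2 * k - j)).map (fun i => w (j + 1 + i)) = w (j + 1) :: l := by
    rw [hn, List.range_succ_eq_map, hl]
    simp only [List.map_cons, List.map_map, add_zero, List.cons.injEq, true_and]
    apply List.map_congr_left
    intro i _
    simp only [Function.comp]
    congr 1
    omega
  have hrev : (List.range (ℓ - 1)).map (fun i => lam (ℓ - i)) = l.reverse := by
    apply List.ext_getElem
    · simp [hl]; omega
    · intro i h1 h2
      simp only [List.length_map, List.length_range] at h1
      simp only [List.getElem_map, List.getElem_range, List.getElem_reverse, hl, List.length_map,
        List.length_range]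
      rw [hlam _ (by omega) (by omega)]
      congr 1
      omega
  have hε20 : ε2 ≠ 0 := by
    rw [hε2]; exact mul_ne_zero (pow_ne_zero _ (neg_ne_zero.mpr one_ne_zero)) hε
  have hsq : ((-1 : ZMod p) ^ (k + j + 1)) * (-1) ^ (k + j + 1) = 1 := by
    rw [← mul_pow]; simp
  have hsign : ∀ X : ZMod p, ε = (-1) ^ (k + j + 1) * X ↔ ε2 = X := by
    intro X
    rw [hε2]
    constructor <;> intro h
    · rw [h, ← mul_assoc, hsq, one_mul]
    · rw [← h, ← mul_assoc, hsq, one_mul]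
  have hc : ε1 / (ε2 * ω) = -ω⁻¹ := by
    rw [hε1, neg_div, ← div_div, div_self hε20, one_div]
  have key : ∀ c, cfrac L = c ↔ ε2 = w (j + 1) + l.foldr (fun a y => (a + y)⁻¹) (-c) := by
    intro c
    rw [hL, hrev, cfrac_append_one, List.foldr_reverse, foldl_eq_iff, hlam 1 le_rfl (by omega)]
    constructor <;> intro h
    · rw [← h]; ring
    · rw [h]; ring
  rw [hsign, hsign, hword, List.cons_append, cfrac_cons_append, cfrac_cons_eq, hc, key, key,
    neg_neg, neg_zero]
  exact ⟨Iff.rfl, Iff.rfl⟩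
end
end

section
/- The continuants of the scalars w_2, ..., w_{2k} in F_p satisfy ⟨w_2, w_3, ..., w_{2k}⟩ = (−1)^k and ⟨w_2, w_3, ..., w_{2k−1}⟩ = 2·(−1)^{k+1}·ω_k. -/
noncomputable section

theorem cont_range_add_two {R : Type*} [CommRing R] (f : ℕ → R) (n : ℕ) :
    cont ((List.range (n + 2)).map f)
      = f (n + 1) * cont ((List.range (n + 1)).map f) + cont ((List.range n).map f) := by
  simp [cont, List.range_succ, List.foldl_append]

/-- Products of a sequence `g` satisfy the continuant recursion when `g` does the right thing. -/
theorem prod_rec {F : Type*} [Field F] (w c : ℕ → F) (n : ℕ)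
    (h : w (n + 1) * w (n + 2) * (c n * c (n + 1)) = w (n + 1) * w (n + 2) * c n + 1) :
    ∏ i ∈ Finset.range (n + 2), (w (i + 1) * c i)
      = w (n + 2) * ∏ i ∈ Finset.range (n + 1), (w (i + 1) * c i)
        + ∏ i ∈ Finset.range n, (w (i + 1) * c i) := by
  rw [Finset.prod_range_succ, Finset.prod_range_succ]
  linear_combination (∏ i ∈ Finset.range n, (w (i + 1) * c i)) * h

theorem stmt_17_aux {F : Type*} [Field F] (m : ℕ) (w : ℕ → F) (ω : F)
    (hnz : ∀ a : ℕ, 1 ≤ a → a ≤ 2 * m + 2 → (a : F) ≠ 0)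
    (hω : ω = (-1) ^ m * ∏ i ∈ Finset.range (m + 1), ((2 * (i : F) + 1) / (2 * (i : F) + 2)))
    (hw1 : w 1 * ω = (2 * (m : F) + 1) / (2 * m + 2))
    (hw : ∀ n : ℕ, n + 2 ≤ 2 * m + 2 → w (n + 1) * w (n + 2) =
      (2 * (m : F) - 2 * n - 1) * (2 * m - 2 * n + 1) / ((n + 1) * (2 * m + 1 - n))) :
    cont ((List.range (2 * m + 1)).map fun i => w (i + 2)) = (-1 : F) ^ (m + 1) ∧
    cont ((List.range (2 * m)).map fun i => w (i + 2)) = 2 * (-1 : F) ^ m * ω := by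
  have hodd1 : ∀ n : ℕ, n ≤ 2 * m + 1 → (2 * (m : F) - 2 * n + 1) ≠ 0 := by
    intro n hn h0
    rcases le_or_gt n m with h | h
    · obtain ⟨t, rfl⟩ := Nat.exists_eq_add_of_le h
      refine hnz (2 * t + 1) (by omega) (by omega) ?_
      push_cast at h0 ⊢
      linear_combination h0
    · obtain ⟨t, rfl⟩ := Nat.exists_eq_add_of_lt h
      refine hnz (2 * t + 1) (by omega) (by omega) ?_
      push_cast at h0 ⊢
      linear_combination -h0
  have hodd2 : ∀ n : ℕ, n + 2 ≤ 2 * m + 2 → (2 * (m : F) - 2 * n - 1) ≠ 0 := by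
    intro n hn
    have := hodd1 (n + 1) (by omega)
    push_cast at this
    intro h0; apply this; linear_combination h0
  have hsucc : ∀ n : ℕ, n + 1 ≤ 2 * m + 2 → ((n : F) + 1) ≠ 0 := by
    intro n hn
    have := hnz (n + 1) (by omega) hn
    push_cast at this; exact this
  have hsub : ∀ n : ℕ, n + 2 ≤ 2 * m + 2 → (2 * (m : F) + 1 - n) ≠ 0 := by
    intro n hn
    have := hnz (2 * m + 1 - n) (by omega) (by omega)
    rw [Nat.cast_sub (by omega)] at this
    push_cast at this; exact this
  let c : ℕ → F := fun n => (2 * (m : F) + 1 - n) / (2 * m - 2 * n + 1)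
  let d : ℕ → F := fun n => -((n : F) + 1) / (2 * m - 2 * n + 1)
  let L : ℕ → F := fun n => ∏ i ∈ Finset.range n, (w (i + 1) * c i)
  let N : ℕ → F := fun n => ∏ i ∈ Finset.range n, (w (i + 1) * d i)
  have hcc : ∀ n : ℕ, n + 2 ≤ 2 * m + 2 →
      w (n + 1) * w (n + 2) * (c n * c (n + 1)) = (2 * (m : F) - n) / (n + 1) := by
    intro n hn
    have h1 := hodd1 n (by omega)
    have h1f : 2 * ((m : F) - n) + 1 ≠ 0 := by
      intro h0; apply h1; linear_combination h0
    have h2 := hodd2 n hn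
    have h2f : 2 * ((m : F) - n) - 1 ≠ 0 := by
      intro h0; apply h2; linear_combination h0
    have h2' : (2 * (m : F) - 2 * (n + 1) + 1) ≠ 0 := by
      intro h0; apply h2; linear_combination h0
    have h3 := hsucc n (by omega)
    have h4 := hsub n hn
    rw [hw n hn]
    simp only [c]
    push_cast
    rw [show (2 * (m : F) - 2 * (n + 1) + 1) = 2 * m - 2 * n - 1 by ring]
    field_simp
    ring
  have hdd : ∀ n : ℕ, n + 2 ≤ 2 * m + 2 →
      w (n + 1) * w (n + 2) * (d n * d (n + 1)) = ((n : F) + 2) / (2 * m + 1 - n) := by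
    intro n hn
    have h1 := hodd1 n (by omega)
    have h1f : 2 * ((m : F) - n) + 1 ≠ 0 := by
      intro h0; apply h1; linear_combination h0
    have h2 := hodd2 n hn
    have h2f : 2 * ((m : F) - n) - 1 ≠ 0 := by
      intro h0; apply h2; linear_combination h0
    have h3 := hsucc n (by omega)
    have h4 := hsub n hn
    rw [hw n hn]
    simp only [d]
    push_cast
    rw [show (2 * (m : F) - 2 * (n + 1) + 1) = 2 * m - 2 * n - 1 by ring]
    field_simp
    ring
  have hLrec : ∀ n : ℕ, n + 2 ≤ 2 * m + 2 → L (n + 2) = w (n + 2) * L (n + 1) + L n := by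
    intro n hn
    apply prod_rec
    have h1 := hodd1 n (by omega)
    have h1f : 2 * ((m : F) - n) + 1 ≠ 0 := by
      intro h0; apply h1; linear_combination h0
    have h3 := hsucc n (by omega)
    have h4 := hsub n hn
    rw [hcc n hn, hw n hn]
    simp only [c]
    field_simp
    ring
  have hNrec : ∀ n : ℕ, n + 2 ≤ 2 * m + 2 → N (n + 2) = w (n + 2) * N (n + 1) + N n := by
    intro n hn
    apply prod_rec
    have h1 := hodd1 n (by omega)
    have h1f : 2 * ((m : F) - n) + 1 ≠ 0 := by
      intro h0; apply h1; linear_combination h0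
    have h3 := hsucc n (by omega)
    have h4 := hsub n hn
    rw [hdd n hn, hw n hn]
    simp only [d]
    field_simp
    ring
  have hm1 : (2 * (m : F) + 1) ≠ 0 := by simpa using hodd1 0 (by omega)
  have hm2 : (2 * (m : F) + 2) ≠ 0 := by
    have := hnz (2 * m + 2) (by omega) le_rfl
    push_cast at this; exact this
  have hL0 : L 0 = 1 := by simp [L]
  have hN0 : N 0 = 1 := by simp [N]
  have hL1 : L 1 = w 1 := by
    simp [L, c, hm1]
  have hN1 : N 1 = - w 1 / (2 * m + 1) := by
    simp [N, d]; ring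
  have hone : ω * (L 1 - N 1) = 1 := by
    rw [hL1, hN1]
    have : ω * (w 1 - - w 1 / (2 * m + 1)) = (w 1 * ω) * ((2 * m + 2) / (2 * m + 1)) := by
      field_simp; ring
    rw [this, hw1, div_mul_div_comm, mul_comm]
    exact div_self (mul_ne_zero hm2 hm1)
  have hK : ∀ n : ℕ, n + 1 ≤ 2 * m + 2 →
      cont ((List.range n).map fun i => w (i + 2)) = ω * (L (n + 1) - N (n + 1)) := by
    intro n
    induction n using Nat.strong_induction_on with
    | _ n ih =>
      intro hn
      match n, ih, hn with
      | 0, _, _ => rw [hone]; simp [cont]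
      | 1, _, hn =>
        rw [hLrec 0 (by omega), hNrec 0 (by omega)]
        have : cont ((List.range 1).map fun i => w (i + 2)) = w 2 := by
          simp [cont, List.range_succ]
        rw [this, hL0, hN0]
        linear_combination (-w 2) * hone
      | n + 2, ih, hn =>
        rw [cont_range_add_two, ih (n + 1) (by omega) (by omega), ih n (by omega) (by omega),
          hLrec (n + 1) (by omega), hNrec (n + 1) (by omega)]
        ring
  have hcas : ∀ n : ℕ, n + 1 ≤ 2 * m + 2 →
      ω * (L (n + 1) * N n - L n * N (n + 1)) = (-1) ^ n := by
    intro n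
    induction n with
    | zero => intro _; rw [hL0, hN0]; linear_combination hone
    | succ n ih =>
      intro hn
      rw [hLrec n (by omega), hNrec n (by omega), pow_succ, ← ih (by omega)]
      ring
  have hLodd : ∀ j : ℕ, j ≤ m → L (2 * j + 1)
      = w 1 * ∏ i ∈ Finset.range j, ((2 * (m : F) - 2 * i - 1) / (2 * i + 2)) := by
    intro j
    induction j with
    | zero => intro _; simp [hL1]
    | succ j ih =>
      intro hj
      rw [Finset.prod_range_succ, ← mul_assoc, ← ih (by omega)]
      have h := hcc (2 * j + 1) (by omega)
      have e : L (2 * (j + 1) + 1) = L (2 * j + 1) *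
          (w (2 * j + 1 + 1) * w (2 * j + 1 + 2) * (c (2 * j + 1) * c (2 * j + 1 + 1))) := by
        simp only [L]
        rw [show 2 * (j + 1) + 1 = 2 * j + 1 + 1 + 1 by ring, Finset.prod_range_succ,
          Finset.prod_range_succ]
        ring
      rw [e, h]
      push_cast
      congr 2 <;> ring
  have hNodd : ∀ j : ℕ, j ≤ m → N (2 * j + 1)
      = - w 1 / (2 * m + 1) * ∏ i ∈ Finset.range j, ((2 * (i : F) + 3) / (2 * m - 2 * i)) := by
    intro j
    induction j with
    | zero => intro _; simp [hN1]
    | succ j ih =>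
      intro hj
      rw [Finset.prod_range_succ, ← mul_assoc, ← ih (by omega)]
      have h := hdd (2 * j + 1) (by omega)
      have e : N (2 * (j + 1) + 1) = N (2 * j + 1) *
          (w (2 * j + 1 + 1) * w (2 * j + 1 + 2) * (d (2 * j + 1) * d (2 * j + 1 + 1))) := by
        simp only [N]
        rw [show 2 * (j + 1) + 1 = 2 * j + 1 + 1 + 1 by ring, Finset.prod_range_succ,
          Finset.prod_range_succ]
        ring
      rw [e, h]
      push_cast
      congr 2 <;> ring
  have hPL : ∏ i ∈ Finset.range m, ((2 * (m : F) - 2 * i - 1) / (2 * i + 2))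
      = (∏ i ∈ Finset.range m, (2 * (i : F) + 1)) / ∏ i ∈ Finset.range m, (2 * (i : F) + 2) := by
    rw [Finset.prod_div_distrib, ← Finset.prod_range_reflect (fun i : ℕ => (2 * (i : F) + 1))]
    congr 1
    apply Finset.prod_congr rfl
    intro i hi
    have hi := Finset.mem_range.1 hi
    rw [show m - 1 - i = m - (i + 1) by omega, Nat.cast_sub (by omega)]
    push_cast; ring
  have hPN : ∏ i ∈ Finset.range m, ((2 * (i : F) + 3) / (2 * m - 2 * i))
      = (2 * m + 1) * (∏ i ∈ Finset.range m, (2 * (i : F) + 1))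
        / ∏ i ∈ Finset.range m, (2 * (i : F) + 2) := by
    rw [Finset.prod_div_distrib, ← Finset.prod_range_reflect (fun i : ℕ => (2 * (i : F) + 2))]
    congr 1
    · have h1 := Finset.prod_range_succ (fun i : ℕ => (2 * (i : F) + 1)) m
      have h2 := Finset.prod_range_succ' (fun i : ℕ => (2 * (i : F) + 1)) m
      rw [h1] at h2
      rw [mul_comm, h2]
      simp only [Nat.cast_zero, mul_zero, zero_add, mul_one]
      apply Finset.prod_congr rfl
      intro i hi
      push_cast; ring
    · apply Finset.prod_congr rfl
      intro i hi
      have hi := Finset.mem_range.1 hi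
      rw [show m - 1 - i = m - (i + 1) by omega, Nat.cast_sub (by omega)]
      push_cast; ring
  have hsq : ((-1 : F) ^ m) * (-1) ^ m = 1 := by
    rw [← mul_pow]; simp
  have hLf : L (2 * m + 1) = (-1) ^ m := by
    rw [hLodd m le_rfl, hPL]
    rw [Finset.prod_range_succ, Finset.prod_div_distrib] at hω
    rw [hω] at hw1
    field_simp at hw1
    have : w 1 * (-1) ^ m * ((∏ i ∈ Finset.range m, (2 * (i : F) + 1))
        / ∏ i ∈ Finset.range m, (2 * (i : F) + 2)) = 1 := by
      have hr : (2 * (m : F) + 1) / (2 * m + 2) ≠ 0 := div_ne_zero hm1 hm2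
      apply mul_right_cancel₀ hr
      field_simp
      linear_combination hw1
    linear_combination (-1) ^ m * this - w 1 * ((∏ i ∈ Finset.range m, (2 * (i : F) + 1))
        / ∏ i ∈ Finset.range m, (2 * (i : F) + 2)) * hsq
  have hNf : N (2 * m + 1) = - (-1) ^ m := by
    rw [← hLf, hLodd m le_rfl, hNodd m le_rfl, hPL, hPN]
    field_simp
  have hLend : L (2 * m + 2) = 0 := by
    simp only [L]
    rw [Finset.prod_range_succ]
    simp [c]
  constructor
  · rw [hK (2 * m + 1) (by omega)]
    have h := hcas (2 * m + 1) (by omega)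
    rw [show 2 * m + 1 + 1 = 2 * m + 2 by ring, hLend, hLf] at *
    have e : (-1 : F) ^ (2 * m + 1) = -1 := by rw [pow_succ, pow_mul]; simp
    rw [e] at h
    rw [pow_succ]
    linear_combination (-1) ^ m * h + ω * N (2 * m + 2) * hsq
  · rw [hK (2 * m) (by omega), hLf, hNf]
    ring


theorem stmt_17 (p k : ℕ) [Fact (Nat.Prime p)] (hodd : Odd p)
    (hk1 : 1 ≤ k) (hk2 : 2 * k < p)
    (ω : ZMod p)
    (hω : ω = (-1) ^ (k - 1) * ∏ i ∈ Finset.Icc 1 k, (1 - (2 * (i : ZMod p))⁻¹))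
    (w : ℕ → ZMod p)
    (hwne : ∀ i, 1 ≤ i → i ≤ 2 * k → w i ≠ 0)
    (hw1 : w 1 = (2 * (k : ZMod p) - 1) * (2 * (k : ZMod p) * ω)⁻¹)
    (hwrec : ∀ i, 1 ≤ i → i ≤ 2 * k - 1 →
      w (i + 1) * w i =
        (2 * (k : ZMod p) - 2 * (i : ZMod p) - 1) * (2 * (k : ZMod p) - 2 * (i : ZMod p) + 1)
          * ((i : ZMod p) * (2 * (k : ZMod p) - (i : ZMod p)))⁻¹) :
    cont ((List.range (2 * k - 1)).map fun i => w (i + 2)) = (-1 : ZMod p) ^ k ∧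
    cont ((List.range (2 * k - 2)).map fun i => w (i + 2)) = 2 * (-1 : ZMod p) ^ (k + 1) * ω := by
  obtain ⟨m, rfl⟩ := Nat.exists_eq_add_of_le' hk1
  have hnz : ∀ a : ℕ, 1 ≤ a → a ≤ 2 * m + 2 → (a : ZMod p) ≠ 0 := by
    intro a h1 h2 h0
    rw [ZMod.natCast_eq_zero_iff] at h0
    have := Nat.le_of_dvd (by omega) h0
    omega
  have hprod : ∏ i ∈ Finset.Icc 1 (m + 1), (1 - (2 * (i : ZMod p))⁻¹)
      = ∏ i ∈ Finset.range (m + 1), ((2 * (i : ZMod p) + 1) / (2 * (i : ZMod p) + 2)) := by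
    have hIcc : Finset.Icc 1 (m + 1) = Finset.Ico 1 (m + 2) := by
      ext x; simp only [Finset.mem_Icc, Finset.mem_Ico]; omega
    rw [hIcc, Finset.prod_Ico_eq_prod_range]
    apply Finset.prod_congr (by congr 1)
    intro i hi
    have hi := Finset.mem_range.1 hi
    have h2 : (2 * (i : ZMod p) + 2) ≠ 0 := by
      have := hnz (2 * i + 2) (by omega) (by omega)
      push_cast at this; exact this
    push_cast
    rw [show 2 * (1 + (i : ZMod p)) = 2 * i + 2 by ring, eq_div_iff h2, sub_mul,
      inv_mul_cancel₀ h2]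
    ring
  have hω' : ω = (-1) ^ m * ∏ i ∈ Finset.range (m + 1),
      ((2 * (i : ZMod p) + 1) / (2 * (i : ZMod p) + 2)) := by
    rw [hω, hprod]; simp
  have hω0 : ω ≠ 0 := by
    intro h0
    apply hwne 1 le_rfl (by omega)
    rw [hw1, h0]; simp
  have hm2 : (2 * (m : ZMod p) + 2) ≠ 0 := by
    have := hnz (2 * m + 2) (by omega) le_rfl
    push_cast at this; exact this
  have hw1' : w 1 * ω = (2 * (m : ZMod p) + 1) / (2 * m + 2) := by
    rw [hw1]
    push_cast
    rw [show 2 * ((m : ZMod p) + 1) = 2 * m + 2 by ring]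
    field_simp
    ring
  have key := stmt_17_aux m w ω hnz hω' hw1' (by
    intro n hn
    have h := hwrec (n + 1) (by omega) (by omega)
    rw [mul_comm, h, div_eq_mul_inv]
    push_cast
    congr 1
    · ring
    · congr 1
      ring)
  rw [show 2 * (m + 1) - 1 = 2 * m + 1 by omega, show 2 * (m + 1) - 2 = 2 * m by omega]
  refine ⟨key.1, ?_⟩
  rw [key.2]
  ring
end
end

section
/- In F_p we have the continuant identity ⟨−ω_k, w_1, w_2, ..., w_{2k}, ω_k⟩ = 0, and for every integer j with 1 ≤ j ≤ 2k−1 the finite continued fraction identity [w_{j+1}, ..., w_{2k}] + [w_j, ..., w_1]^{−1} = 0. -/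
noncomputable section

theorem cfrac_cons' {K : Type*} [DivisionRing K] (a : K) (l : List K) :
    cfrac (a :: l) = a + (cfrac l)⁻¹ := by
  cases l <;> simp [cfrac]

theorem int_ne (p : ℕ) (n : ℤ) (h0 : n ≠ 0) (h1 : |n| < p) : (n : ZMod p) ≠ 0 := by
  rw [Ne, ZMod.intCast_zmod_eq_zero_iff_dvd]
  intro h
  exact h0 (Int.eq_zero_of_abs_lt_dvd h h1)

theorem stmt_18 (p k : ℕ) [Fact (Nat.Prime p)] (hodd : Odd p)
    (hk1 : 1 ≤ k) (hk2 : 2 * k < p)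
    (ω : ZMod p)
    (hω : ω = (-1) ^ (k - 1) * ∏ i ∈ Finset.Icc 1 k, (1 - (2 * (i : ZMod p))⁻¹))
    (w : ℕ → ZMod p)
    (hwne : ∀ i, 1 ≤ i → i ≤ 2 * k → w i ≠ 0)
    (hw1 : w 1 = (2 * (k : ZMod p) - 1) * (2 * (k : ZMod p) * ω)⁻¹)
    (hwrec : ∀ i, 1 ≤ i → i ≤ 2 * k - 1 →
      w (i + 1) * w i =
        (2 * (k : ZMod p) - 2 * (i : ZMod p) - 1) * (2 * (k : ZMod p) - 2 * (i : ZMod p) + 1)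
          * ((i : ZMod p) * (2 * (k : ZMod p) - (i : ZMod p)))⁻¹) :
    cont ((-ω) :: (((List.range (2 * k)).map fun i => w (i + 1)) ++ [ω])) = 0 ∧
    ∀ j, 1 ≤ j → j ≤ 2 * k - 1 →
      cfrac ((List.range (2 * k - j)).map fun i => w (j + 1 + i))
        + (cfrac ((List.range j).map fun i => w (j - i)))⁻¹ = 0 := by
  have nz : ∀ n : ℤ, n ≠ 0 → |n| < p → (n : ZMod p) ≠ 0 := int_ne p
  have h2k : (2 * (k : ZMod p)) ≠ 0 := by
    have := nz (2 * k) (by omega) (by rw [abs_lt]; omega)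
    push_cast at this; exact this
  have hodd' : ∀ i : ℕ, 1 ≤ i → i ≤ 2 * k →
      (2 * (k : ZMod p) - 2 * (i : ZMod p) + 1) ≠ 0 := by
    intro i h1 h2
    have := nz (2 * k - 2 * i + 1) (by omega) (by rw [abs_lt]; omega)
    push_cast at this; exact this
  have hi : ∀ i : ℕ, 1 ≤ i → i ≤ 2 * k → (i : ZMod p) ≠ 0 := by
    intro i h1 h2
    have := nz i (by omega) (by rw [abs_lt]; omega)
    push_cast at this; exact this
  have hki : ∀ i : ℕ, i < 2 * k → (2 * (k : ZMod p) - (i : ZMod p)) ≠ 0 := by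
    intro i h2
    have := nz (2 * k - i) (by omega) (by rw [abs_lt]; omega)
    push_cast at this; exact this
  have hr : ∀ i, 1 ≤ i → i ≤ 2 * k - 1 →
      w (i + 1) * w i * ((i : ZMod p) * (2 * (k : ZMod p) - (i : ZMod p))) =
        (2 * (k : ZMod p) - 2 * (i : ZMod p) - 1) * (2 * (k : ZMod p) - 2 * (i : ZMod p) + 1) := by
    intro i h1 h2
    have a1 := hi i h1 (by omega)
    have a2 := hki i (by omega)
    rw [hwrec i h1 h2, inv_mul_cancel_right₀ (mul_ne_zero a1 a2)]
  have hω0 : ω ≠ 0 := by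
    rintro h
    apply hwne 1 le_rfl (by omega)
    rw [hw1, h]; simp
  have hw1' : w 1 * (2 * (k : ZMod p) * ω) = 2 * (k : ZMod p) - 1 := by
    rw [hw1, inv_mul_cancel_right₀ (mul_ne_zero h2k hω0)]
  constructor
  · -- last entry is the negative of the first
    have hlast : w (2 * k) * (2 * (k : ZMod p) * ω) = -(2 * (k : ZMod p) - 1) := by
      obtain ⟨n, rfl⟩ : ∃ n, k = n + 1 := ⟨k - 1, by omega⟩
      obtain ⟨a, ha⟩ : ∃ a : ℕ → ZMod p, ∀ m, a m =
        ∏ i ∈ Finset.Icc 1 m, (1 - (2 * (i : ZMod p))⁻¹) := ⟨_, fun _ => rfl⟩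
      have ha0 : a 0 = 1 := by simp [ha]
      have has : ∀ m, m ≤ n → a (m + 1) * (2 * m + 2) = a m * (2 * m + 1) := by
        intro m hm
        rw [ha, ha, Finset.prod_Icc_succ_top (by omega)]
        have := nz (2 * (m + 1)) (by omega) (by rw [abs_lt]; omega)
        have h := inv_mul_cancel₀ this
        push_cast at h ⊢
        generalize ∏ i ∈ Finset.Icc 1 m, (1 - (2 * (i : ZMod p))⁻¹) = P
        linear_combination (-P) * h
      obtain ⟨ε, hε⟩ : ∃ ε : ZMod p, ε = (-1) ^ n := ⟨_, rfl⟩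
      have hε2 : ε * ε = 1 := by rw [hε, ← mul_pow]; simp
      have hωa : ω = ε * a (n + 1) := by rw [hω, ha, hε]; simp
      have key : ∀ m l, m + l = n → w (2 * m + 1) * a l * (2 * l + 1) =
          ε * a m * (2 * l - 2 * m + 1) := by
        intro m
        induction m with
        | zero =>
          intro l hl
          obtain rfl : l = n := by omega
          have h := has l le_rfl
          rw [hωa] at hw1'
          push_cast at hw1' ⊢
          simp only [mul_zero, zero_add, ha0]
          linear_combination (-w 1) * h + ε * hw1' - w 1 * (2 * l + 2) * a (l + 1) * hε2
        | succ m ih =>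
          intro l hl
          have h := ih (l + 1) (by omega)
          have r1 := hr (2 * m + 1) (by omega) (by omega)
          have r2 := hr (2 * m + 2) (by omega) (by omega)
          have e1 := has m (by omega)
          have e2 := has l (by omega)
          have hu := nz (2 * l - 2 * m + 1) (by omega) (by rw [abs_lt]; omega)
          have hu2 := nz (2 * l - 2 * m + 3) (by omega) (by rw [abs_lt]; omega)
          have hm2 := nz (2 * m + 2) (by omega) (by rw [abs_lt]; omega)
          have hn : (n : ZMod p) = m + l + 1 := by rw [← hl]; push_cast; ring
          rw [show 2 * (m + 1) + 1 = 2 * m + 2 + 1 by ring]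
          rw [show 2 * m + 1 + 1 = 2 * m + 2 by ring] at r1
          push_cast at *
          rw [hn] at r1 r2
          apply mul_left_cancel₀ (mul_ne_zero (mul_ne_zero hu hu2) hm2)
          generalize w (2 * m + 2 + 1) = w3 at *
          generalize w (2 * m + 2) = w2 at *
          generalize w (2 * m + 1) = w1 at *
          generalize a (m + 1) = am' at *
          generalize a (l + 1) = al' at *
          generalize a m = am at *
          generalize a l = al at *
          generalize (m : ZMod p) = M at *
          generalize (l : ZMod p) = L at *
          have s1 : w3 * ((2*L-2*M+1)*(2*L-2*M+3)) * ((2*M+2)*(2*L+2)) =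
            w1 * ((2*L-2*M+1)*(2*L-2*M-1)) * ((2*M+1)*(2*L+3)) := by
            linear_combination (w1 * ((2*M+1)*(2*L+3))) * r2 - (w3 * ((2*M+2)*(2*L+2))) * r1
          linear_combination (-(2*L-2*M+1)*(2*L-2*M+3)*(2*M+2)*w3) * e2 + al' * s1
            + ((2*L-2*M+1)*(2*L-2*M-1)*(2*M+1)) * h
            - ((2*L-2*M+1)*(2*L-2*M+3)*ε*(2*L-2*M-1)) * e1
      have h := key n 0 (by omega)
      have r := hr (2 * n + 1) (by omega) (by omega)
      have e := has n le_rfl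
      have hn3 := nz (1 - 2 * n) (by omega) (by rw [abs_lt]; omega)
      have hn1 := nz (2 * n + 1) (by omega) (by rw [abs_lt]; omega)
      rw [show 2 * (n + 1) = 2 * n + 1 + 1 by ring, hωa]
      push_cast at *
      rw [ha0] at h
      apply mul_left_cancel₀ hn3
      linear_combination w (2 * n + 1 + 1) * ε * (1 - 2 * n) * e
        - w (2 * n + 1 + 1) * (2 * n + 1) * h + r
    have fold : ∀ j, 1 ≤ j → j ≤ 2 * k → ∀ q : ZMod p × ZMod p,
        q = (((List.range j).map fun i => w (i + 1)).foldl
          (fun q a => (a * q.1 + q.2, q.1)) ((-ω, 1) : ZMod p × ZMod p)) →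
        q.1 * (2 * (k : ZMod p) - 2 * (j : ZMod p) + 1) = - w j * j * q.2 := by
      intro j h1
      induction j, h1 using Nat.le_induction with
      | base =>
        intro _ q hq
        simp at hq
        rw [hq]
        simp
        linear_combination (-1 : ZMod p) * hw1'
      | succ j h1 ih =>
        intro h2 q hq
        rw [List.range_succ, List.map_append, List.foldl_append] at hq
        have := ih (by omega) _ rfl
        generalize List.foldl _ _ _ = s at this hq
        simp at hq
        have r := hr j h1 (by omega)
        have c1 := hi j h1 (by omega)
        have c2 := hwne j h1 (by omega)
        rw [hq]
        push_cast
        apply mul_left_cancel₀ (mul_ne_zero c1 c2)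
        linear_combination s.1 * r + (2 * (k : ZMod p) - 2 * (j : ZMod p) - 1) * this
    have hf := fold (2 * k) (by omega) le_rfl _ rfl
    unfold cont
    rw [List.foldl_cons, List.foldl_append]
    simp only [mul_one, add_zero]
    generalize List.foldl _ _ _ = s at hf ⊢
    simp only [List.foldl_cons, List.foldl_nil]
    have hn1 := nz (2 * k - 1) (by omega) (by rw [abs_lt]; omega)
    push_cast at *
    apply mul_left_cancel₀ hn1
    linear_combination (-ω) * hf + s.2 * hlast
  · obtain ⟨y, hy⟩ : ∃ y : ℕ → ZMod p, ∀ j, y j =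
      cfrac ((List.range j).map fun i => w (j - i)) := ⟨_, fun _ => rfl⟩
    obtain ⟨x, hx⟩ : ∃ x : ℕ → ZMod p, ∀ j, x j =
      cfrac ((List.range (2 * k - j)).map fun i => w (j + 1 + i)) := ⟨_, fun _ => rfl⟩
    have y0 : y 0 = 0 := by simp [hy, cfrac]
    have ys : ∀ j, y (j + 1) = w (j + 1) + (y j)⁻¹ := by
      intro j
      rw [hy, hy, List.range_succ_eq_map, List.map_cons, cfrac_cons', List.map_map]
      congr 4
      funext i
      simp
    have xe : x (2 * k) = 0 := by simp [hx, cfrac]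
    have xs : ∀ j, j < 2 * k → x j = w (j + 1) + (x (j + 1))⁻¹ := by
      intro j hj
      rw [hx, hx, show 2 * k - j = (2 * k - (j + 1)) + 1 by omega,
        List.range_succ_eq_map, List.map_cons, cfrac_cons', List.map_map]
      congr 4
      funext i
      simp only [Function.comp]
      congr 1
      omega
    have yf : ∀ j, 1 ≤ j → j ≤ 2 * k →
        y j * (2 * (k : ZMod p) - 2 * (j : ZMod p) + 1) = w j * (2 * k - j) := by
      intro j h1
      induction j, h1 using Nat.le_induction with
      | base =>
        intro _
        rw [ys 0, y0]
        simp
        left; ring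
      | succ j h1 ih =>
        intro h2
        have h := ih (by omega)
        have r := hr j h1 (by omega)
        have c2 := hwne j h1 (by omega)
        have c3 := hki j (by omega)
        have c4 : y j ≠ 0 := by
          intro h0
          rw [h0, zero_mul] at h
          exact mul_ne_zero c2 c3 h.symm
        have c5 := mul_inv_cancel₀ c4
        rw [ys]
        push_cast
        apply mul_left_cancel₀ (mul_ne_zero (mul_ne_zero c2 c3) c4)
        linear_combination (-y j) * r + w j * (2 * k - j) * (2 * k - 2 * j - 1) * c5 - (2 * k - 2 * j - 1) * h
    have ye : y (2 * k) = 0 := by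
      have h := yf (2 * k) (by omega) le_rfl
      have := hodd' (2 * k) (by omega) le_rfl
      push_cast at *
      rw [sub_self, mul_zero] at h
      exact (mul_eq_zero.mp h).resolve_right this
    have main : ∀ d j, 1 ≤ j → j + d = 2 * k → x j + (y j)⁻¹ = 0 := by
      intro d
      induction d with
      | zero =>
        intro j h1 h2
        obtain rfl : j = 2 * k := by omega
        rw [xe, ye]; simp
      | succ d ih =>
        intro j h1 h2
        have h := ih (j + 1) (by omega) (by omega)
        have hxinv : (x (j + 1))⁻¹ = - y (j + 1) := by
          rw [eq_neg_of_add_eq_zero_left h, inv_neg, inv_inv]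
        rw [xs j (by omega), hxinv, ys]
        ring
    intro j h1 h2
    have := main (2 * k - j) j h1 (by omega)
    rw [hx, hy] at this
    exact this
end
end
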